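/- Let n ≥ p be positive integers, let ℒ : ℝ^{n×p} → ℝ be continuously differentiable with Euclidean gradient ∇ℒ, let η, γ, α, k₁, k₂ > 0, and let V(θ,φ) = (k₁/4)‖θᵀθ − I‖² + (k₂/2)‖Sym(θᵀφ)‖². Fix 0 < c < k₁/4. Suppose θ, φ : [0,∞) → ℝ^{n×p} are differentiable, satisfy V(θ(0),φ(0)) ≤ c, and satisfy for all t ≥ 0 the modified dynamics θ' = X_θ − (α/4)θ(I − (θᵀθ)^{-1}), φ' = X_φ − (α/4)θ(θᵀθ)^{-1}(φᵀθ(θᵀθ)^{-1} + θᵀφ), where X_θ = φ − θ(θᵀθ)^{-1}Sym(θᵀφ), X_φ = θ(θᵀθ)^{-1}((θᵀθ)^{-1}θᵀφ·Sym(θᵀφ) − φᵀφ) + (D − θ(θᵀθ)^{-1}Sym(θᵀD))/η and D = −γφ − ∇ℒ(θ). Then V(θ(t),φ(t)) = e^{−αt}·V(θ(0),φ(0)) for all t ≥ 0; in particular the trajectory stays in V^{-1}([0,c]) for all forward time and converges exponentially to V^{-1}(0) = T St(n,p) as t → ∞. -/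

import Mathlib

open Matrix Set Filter

attribute [local instance] Matrix.normedAddCommGroup Matrix.normedSpace

noncomputable section

/-- `Sym(A) = (A + Aᵀ)/2`. -/
def symPart {p : ℕ} (A : Matrix (Fin p) (Fin p) ℝ) : Matrix (Fin p) (Fin p) ℝ :=
  (1 / 2 : ℝ) • (A + Aᵀ)

/-- Euclidean (Frobenius) inner product `⟨A, B⟩ = tr(AᵀB)`. -/
def mInner {m k : ℕ} (A B : Matrix (Fin m) (Fin k) ℝ) : ℝ := (Aᵀ * B).trace

/-- The norm induced from `mInner`. -/
def mNorm {m k : ℕ} (A : Matrix (Fin m) (Fin k) ℝ) : ℝ := Real.sqrt (mInner A A)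

/-- `V(θ,φ) = (k₁/4)‖θᵀθ - I‖² + (k₂/2)‖Sym(θᵀφ)‖²`. -/
def Vfun {n p : ℕ} (k₁ k₂ : ℝ)
    (q : Matrix (Fin n) (Fin p) ℝ × Matrix (Fin n) (Fin p) ℝ) : ℝ :=
  k₁ / 4 * mNorm (q.1ᵀ * q.1 - 1) ^ 2 + k₂ / 2 * mNorm (symPart (q.1ᵀ * q.2)) ^ 2

/-- The extended vector field `X = (X_θ, X_φ)` of system (7) on the ambient space. -/
def extVF {n p : ℕ} (η γ : ℝ)
    (G : Matrix (Fin n) (Fin p) ℝ → Matrix (Fin n) (Fin p) ℝ)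
    (q : Matrix (Fin n) (Fin p) ℝ × Matrix (Fin n) (Fin p) ℝ) :
    Matrix (Fin n) (Fin p) ℝ × Matrix (Fin n) (Fin p) ℝ :=
  (q.2 - q.1 * (q.1ᵀ * q.1)⁻¹ * symPart (q.1ᵀ * q.2),
    q.1 * (q.1ᵀ * q.1)⁻¹ *
        ((q.1ᵀ * q.1)⁻¹ * (q.1ᵀ * q.2) * symPart (q.1ᵀ * q.2) - q.2ᵀ * q.2) +
      η⁻¹ • ((-(γ • q.2) - G q.1) -
        q.1 * (q.1ᵀ * q.1)⁻¹ * symPart (q.1ᵀ * (-(γ • q.2) - G q.1))))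

/-- The modified (feedback) vector field `Y` of system (7). -/
def fbVF {n p : ℕ} (η γ α : ℝ)
    (G : Matrix (Fin n) (Fin p) ℝ → Matrix (Fin n) (Fin p) ℝ)
    (q : Matrix (Fin n) (Fin p) ℝ × Matrix (Fin n) (Fin p) ℝ) :
    Matrix (Fin n) (Fin p) ℝ × Matrix (Fin n) (Fin p) ℝ :=
  ((extVF η γ G q).1 - (α / 4) • (q.1 * (1 - (q.1ᵀ * q.1)⁻¹)),
    (extVF η γ G q).2 -
      (α / 4) • (q.1 * (q.1ᵀ * q.1)⁻¹ * (q.2ᵀ * q.1 * (q.1ᵀ * q.1)⁻¹ + q.1ᵀ * q.2)))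

lemma aux_mInner_self {m k : ℕ} (A : Matrix (Fin m) (Fin k) ℝ) :
    mInner A A = ∑ i, ∑ j, A i j ^ 2 := by
  unfold mInner
  simp only [Matrix.trace, Matrix.diag, Matrix.mul_apply, Matrix.transpose_apply]
  rw [Finset.sum_comm]
  simp only [sq]

lemma aux_mNorm_sq {m k : ℕ} (A : Matrix (Fin m) (Fin k) ℝ) :
    mNorm A ^ 2 = mInner A A := by
  unfold mNorm
  rw [Real.sq_sqrt]
  rw [aux_mInner_self]
  positivity

lemma aux_isUnit {p : ℕ} (P : Matrix (Fin p) (Fin p) ℝ)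
    (h : mInner (P - 1) (P - 1) < 1) : IsUnit P.det := by
  rw [isUnit_iff_ne_zero]
  intro hdet
  obtain ⟨v, hv, hPv⟩ := Matrix.exists_mulVec_eq_zero_iff.mpr hdet
  have h1 : ∀ i, v i ^ 2 = (∑ j, (P - 1) i j * v j) ^ 2 := by
    intro i
    have : (P - 1) *ᵥ v = -v := by rw [Matrix.sub_mulVec, hPv]; simp
    have h2 := congrFun this i
    simp only [Matrix.mulVec, dotProduct, Pi.neg_apply] at h2
    rw [h2]; ring
  have hpos : 0 < ∑ i, v i ^ 2 := by
    obtain ⟨i, hi⟩ := Function.ne_iff.mp hv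
    have hi' : v i ≠ 0 := hi
    exact Finset.sum_pos' (fun j _ => sq_nonneg _) ⟨i, Finset.mem_univ _, by positivity⟩
  have h3 : ∑ i, v i ^ 2 ≤ ∑ i, (∑ j, (P - 1) i j ^ 2) * ∑ j, v j ^ 2 := by
    refine Finset.sum_le_sum fun i _ => ?_
    rw [h1 i]
    exact Finset.sum_mul_sq_le_sq_mul_sq _ _ _
  rw [← Finset.sum_mul, ← aux_mInner_self] at h3
  nlinarith

lemma aux_deriv_mul {a b d : ℕ} {A : ℝ → Matrix (Fin a) (Fin b) ℝ}
    {B : ℝ → Matrix (Fin b) (Fin d) ℝ} {A' : Matrix (Fin a) (Fin b) ℝ}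
    {B' : Matrix (Fin b) (Fin d) ℝ} {t : ℝ}
    (hA : HasDerivAt A A' t) (hB : HasDerivAt B B' t) :
    HasDerivAt (fun s => A s * B s) (A' * B t + A t * B') t := by
  have hA1 : ∀ i j, HasDerivAt (fun s => A s i j) (A' i j) t := fun i j =>
    hasDerivAt_pi.mp (hasDerivAt_pi.mp hA i) j
  have hB1 : ∀ i j, HasDerivAt (fun s => B s i j) (B' i j) t := fun i j =>
    hasDerivAt_pi.mp (hasDerivAt_pi.mp hB i) j
  refine hasDerivAt_pi.mpr fun i => hasDerivAt_pi.mpr fun j => ?_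
  have h := HasDerivAt.fun_sum (u := Finset.univ)
    (fun k _ => (hA1 i k).mul (hB1 k j))
  simp only [Matrix.mul_apply, Matrix.add_apply, ← Finset.sum_add_distrib]
  exact h

lemma aux_deriv_transpose {a b : ℕ} {A : ℝ → Matrix (Fin a) (Fin b) ℝ}
    {A' : Matrix (Fin a) (Fin b) ℝ} {t : ℝ}
    (hA : HasDerivAt A A' t) : HasDerivAt (fun s => (A s)ᵀ) A'ᵀ t :=
  hasDerivAt_pi.mpr fun i => hasDerivAt_pi.mpr fun j =>
    hasDerivAt_pi.mp (hasDerivAt_pi.mp hA j) i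

lemma aux_deriv_trace {a : ℕ} {A : ℝ → Matrix (Fin a) (Fin a) ℝ}
    {A' : Matrix (Fin a) (Fin a) ℝ} {t : ℝ}
    (hA : HasDerivAt A A' t) : HasDerivAt (fun s => (A s).trace) A'.trace t := by
  have h := HasDerivAt.fun_sum (u := Finset.univ)
    (fun i _ => hasDerivAt_pi.mp (hasDerivAt_pi.mp hA i) i)
  exact h

lemma aux_deriv_mInner {a b : ℕ} {A : ℝ → Matrix (Fin a) (Fin b) ℝ}
    {A' : Matrix (Fin a) (Fin b) ℝ} {t : ℝ}
    (hA : HasDerivAt A A' t) :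
    HasDerivAt (fun s => mInner (A s) (A s)) (2 * mInner (A t) A') t := by
  have h := aux_deriv_trace (aux_deriv_mul (aux_deriv_transpose hA) hA)
  unfold mInner
  convert h using 1
  rw [Matrix.trace_add, ← Matrix.trace_transpose (A'ᵀ * A t), Matrix.transpose_mul,
    Matrix.transpose_transpose]
  ring

lemma aux_symPart_transpose {p : ℕ} (A : Matrix (Fin p) (Fin p) ℝ) :
    (symPart A)ᵀ = symPart A := by
  simp [symPart, add_comm]

lemma aux_deriv_symPart {p : ℕ} {A : ℝ → Matrix (Fin p) (Fin p) ℝ}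
    {A' : Matrix (Fin p) (Fin p) ℝ} {t : ℝ} (hA : HasDerivAt A A' t) :
    HasDerivAt (fun s => symPart (A s)) (symPart A') t :=
  (hA.add (aux_deriv_transpose hA)).const_smul (1 / 2 : ℝ)

/-- Pairing with a symmetric matrix ignores the skew part. -/
lemma aux_mInner_symPart {p : ℕ} (S A : Matrix (Fin p) (Fin p) ℝ) (hS : Sᵀ = S) :
    mInner S (symPart A) = (S * A).trace := by
  unfold mInner symPart
  rw [hS, Matrix.mul_smul, Matrix.trace_smul, Matrix.mul_add, Matrix.trace_add,
    ← Matrix.trace_transpose (S * Aᵀ), Matrix.transpose_mul, Matrix.transpose_transpose, hS,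
    Matrix.trace_mul_comm A S, smul_eq_mul]
  ring

/-- The algebra for the first term. -/
lemma aux_alg1 {n p : ℕ} (η γ α : ℝ)
    (G : Matrix (Fin n) (Fin p) ℝ → Matrix (Fin n) (Fin p) ℝ)
    (θ φ : Matrix (Fin n) (Fin p) ℝ) (hu : IsUnit (θᵀ * θ).det) :
    θᵀ * (fbVF η γ α G (θ, φ)).1 =
      (θᵀ * φ - symPart (θᵀ * φ)) - (α / 4) • (θᵀ * θ - 1) := by
  simp only [fbVF, extVF, Matrix.mul_sub, Matrix.mul_smul, Matrix.mul_one]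
  rw [← Matrix.mul_assoc θᵀ (θ * _) _, ← Matrix.mul_assoc θᵀ θ, Matrix.mul_nonsing_inv _ hu,
    Matrix.one_mul]

lemma aux_alg2 {n p : ℕ} (η γ α : ℝ)
    (G : Matrix (Fin n) (Fin p) ℝ → Matrix (Fin n) (Fin p) ℝ)
    (θ φ : Matrix (Fin n) (Fin p) ℝ) (hu : IsUnit (θᵀ * θ).det) :
    θᵀ * (fbVF η γ α G (θ, φ)).2 =
      ((θᵀ * θ)⁻¹ * (θᵀ * φ) * symPart (θᵀ * φ) - φᵀ * φ) +
      η⁻¹ • (θᵀ * (-(γ • φ) - G θ) - symPart (θᵀ * (-(γ • φ) - G θ))) -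
      (α / 4) • (φᵀ * θ * (θᵀ * θ)⁻¹ + θᵀ * φ) := by
  have key : ∀ X : Matrix (Fin p) (Fin p) ℝ, θᵀ * (θ * (θᵀ * θ)⁻¹ * X) = X := by
    intro X
    rw [← Matrix.mul_assoc θᵀ (θ * _) _, ← Matrix.mul_assoc θᵀ θ, Matrix.mul_nonsing_inv _ hu,
      Matrix.one_mul]
  simp only [fbVF, extVF]
  rw [Matrix.mul_sub, Matrix.mul_add, Matrix.mul_smul, Matrix.mul_smul,
    Matrix.mul_sub θᵀ (-(γ • φ) - G θ), key, key, key]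

lemma aux_pair1 {n p : ℕ} (η γ α : ℝ)
    (G : Matrix (Fin n) (Fin p) ℝ → Matrix (Fin n) (Fin p) ℝ)
    (θ φ : Matrix (Fin n) (Fin p) ℝ) (hu : IsUnit (θᵀ * θ).det) :
    (fbVF η γ α G (θ, φ)).1ᵀ * θ + θᵀ * (fbVF η γ α G (θ, φ)).1 =
      -(α / 2) • (θᵀ * θ - 1) := by
  have h : (fbVF η γ α G (θ, φ)).1ᵀ * θ = (θᵀ * (fbVF η γ α G (θ, φ)).1)ᵀ := by
    rw [Matrix.transpose_mul, Matrix.transpose_transpose]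
  rw [h, aux_alg1 η γ α G θ φ hu]
  simp only [Matrix.transpose_sub, Matrix.transpose_smul, aux_symPart_transpose,
    Matrix.transpose_mul, Matrix.transpose_transpose, Matrix.transpose_one]
  simp only [symPart, Matrix.transpose_mul, Matrix.transpose_transpose]
  module

lemma aux_pair2 {n p : ℕ} (η γ α : ℝ)
    (G : Matrix (Fin n) (Fin p) ℝ → Matrix (Fin n) (Fin p) ℝ)
    (θ φ : Matrix (Fin n) (Fin p) ℝ) (hu : IsUnit (θᵀ * θ).det) :
    mInner (symPart (θᵀ * φ))
      (symPart ((fbVF η γ α G (θ, φ)).1ᵀ * φ + θᵀ * (fbVF η γ α G (θ, φ)).2)) =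
      -(α / 2) * mInner (symPart (θᵀ * φ)) (symPart (θᵀ * φ)) := by
  have hS := aux_symPart_transpose (θᵀ * φ)
  rw [aux_mInner_symPart _ _ hS, aux_mInner_symPart _ _ hS, aux_alg2 η γ α G θ φ hu]
  have hP : ((θᵀ * θ)⁻¹)ᵀ = (θᵀ * θ)⁻¹ := by
    rw [Matrix.transpose_nonsing_inv, Matrix.transpose_mul, Matrix.transpose_transpose]
  have h1 : (fbVF η γ α G (θ, φ)).1ᵀ * φ =
      φᵀ * φ - symPart (θᵀ * φ) * (θᵀ * θ)⁻¹ * (θᵀ * φ)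
        - (α / 4) • (θᵀ * φ - (θᵀ * θ)⁻¹ * (θᵀ * φ)) := by
    simp only [fbVF, extVF, Matrix.transpose_sub, Matrix.transpose_smul, Matrix.transpose_mul,
      Matrix.transpose_one, hP, hS, Matrix.sub_mul, Matrix.smul_mul, Matrix.mul_assoc,
      Matrix.one_mul]
  rw [h1]
  have hD : ((symPart (θᵀ * φ)) * (θᵀ * (-(γ • φ) - G θ))).trace =
      ((symPart (θᵀ * φ)) * symPart (θᵀ * (-(γ • φ) - G θ))).trace := by
    rw [← aux_mInner_symPart _ _ hS]
    unfold mInner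
    rw [hS]
  have hQ : φᵀ * θ = (θᵀ * φ)ᵀ := by rw [Matrix.transpose_mul, Matrix.transpose_transpose]
  rw [hQ]
  generalize θᵀ * (-(γ • φ) - G θ) = D at *
  generalize φᵀ * φ = F at *
  generalize (θᵀ * θ)⁻¹ = Q at *
  generalize symPart (θᵀ * φ) = S at *
  generalize θᵀ * φ = M at *
  have e1 : (S * (Q * M * S)).trace = (S * (S * Q * M)).trace := by
    rw [Matrix.trace_mul_comm]
    rw [Matrix.trace_mul_comm]
    rw [← Matrix.mul_assoc, Matrix.trace_mul_comm]
    simp only [Matrix.mul_assoc]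
  have e2 : (S * (Mᵀ * Q)).trace = (S * (Q * M)).trace := by
    rw [← Matrix.trace_transpose, Matrix.transpose_mul, Matrix.transpose_mul,
      Matrix.transpose_transpose, hP, hS, Matrix.trace_mul_comm]
  simp only [Matrix.mul_add, Matrix.mul_sub, Matrix.mul_smul, Matrix.trace_add, Matrix.trace_sub,
    Matrix.trace_smul, smul_eq_mul, e1, e2, hD]
  ring

lemma aux_mInner_smul {m k : ℕ} (A B : Matrix (Fin m) (Fin k) ℝ) (r : ℝ) :
    mInner A (r • B) = r * mInner A B := by
  simp [mInner]

lemma aux_V_deriv {n p : ℕ} (k₁ k₂ : ℝ) (θ φ : ℝ → Matrix (Fin n) (Fin p) ℝ)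
    (θ' φ' : Matrix (Fin n) (Fin p) ℝ) (t : ℝ)
    (hθ : HasDerivAt θ θ' t) (hφ : HasDerivAt φ φ' t) :
    HasDerivAt (fun s => Vfun k₁ k₂ (θ s, φ s))
      (k₁ / 4 * (2 * mInner ((θ t)ᵀ * θ t - 1) (θ'ᵀ * θ t + (θ t)ᵀ * θ')) +
       k₂ / 2 * (2 * mInner (symPart ((θ t)ᵀ * φ t))
         (symPart (θ'ᵀ * φ t + (θ t)ᵀ * φ')))) t := by
  simp only [Vfun, aux_mNorm_sq]
  have hT := aux_deriv_transpose hθ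
  have h1 := aux_deriv_mInner ((aux_deriv_mul hT hθ).sub_const 1)
  have h2 := aux_deriv_mInner (aux_deriv_symPart (aux_deriv_mul hT hφ))
  exact (h1.const_mul _).add (h2.const_mul _)

/-- Theorem 1: along trajectories of the feedback system (7)
starting in `V⁻¹([0,c])` with `0 < c < k₁/4`, `V` decays exactly exponentially:
`V(θ(t),φ(t)) = e^{-αt}·V(θ(0),φ(0))`; in particular the trajectory stays in
`V⁻¹([0,c])` for all forward time and converges exponentially to
`V⁻¹(0) = T St(n,p)` as `t → ∞`. -/
theorem stmt11 (n p : ℕ) (hp : 0 < p) (hpn : p ≤ n)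
    (L : Matrix (Fin n) (Fin p) ℝ → ℝ) (hC1 : ContDiff ℝ 1 L)
    (G : Matrix (Fin n) (Fin p) ℝ → Matrix (Fin n) (Fin p) ℝ)
    (L' : Matrix (Fin n) (Fin p) ℝ → (Matrix (Fin n) (Fin p) ℝ →L[ℝ] ℝ))
    (hLdiff : ∀ X, HasFDerivAt L (L' X) X)
    (hLgrad : ∀ X H, L' X H = mInner (G X) H)
    (η γ α k₁ k₂ : ℝ) (hη : 0 < η) (hγ : 0 < γ) (hα : 0 < α)
    (hk₁ : 0 < k₁) (hk₂ : 0 < k₂)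
    (c : ℝ) (hc0 : 0 < c) (hck : c < k₁ / 4)
    (θ φ : ℝ → Matrix (Fin n) (Fin p) ℝ)
    (h0 : Vfun k₁ k₂ (θ 0, φ 0) ≤ c)
    (hθ : ∀ t ≥ (0 : ℝ), HasDerivAt θ (fbVF η γ α G (θ t, φ t)).1 t)
    (hφ : ∀ t ≥ (0 : ℝ), HasDerivAt φ (fbVF η γ α G (θ t, φ t)).2 t) :
    (∀ t ≥ (0 : ℝ),
        Vfun k₁ k₂ (θ t, φ t) = Real.exp (-(α * t)) * Vfun k₁ k₂ (θ 0, φ 0)) ∧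
    (∀ t ≥ (0 : ℝ), Vfun k₁ k₂ (θ t, φ t) ≤ c) ∧
    Filter.Tendsto (fun t => Vfun k₁ k₂ (θ t, φ t)) Filter.atTop (nhds 0) := by
  have hdV := fun t ht => aux_V_deriv k₁ k₂ θ φ _ _ t (hθ t ht) (hφ t ht)
  -- on the sublevel set the derivative is `-α V`
  have hder : ∀ t ≥ (0 : ℝ), Vfun k₁ k₂ (θ t, φ t) ≤ c →
      HasDerivAt (fun s => Vfun k₁ k₂ (θ s, φ s)) (-α * Vfun k₁ k₂ (θ t, φ t)) t := by
    intro t ht hV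
    have hu : IsUnit ((θ t)ᵀ * θ t).det := by
      apply aux_isUnit
      simp only [Vfun, aux_mNorm_sq] at hV
      have : 0 ≤ mInner (symPart ((θ t)ᵀ * φ t)) (symPart ((θ t)ᵀ * φ t)) := by
        rw [aux_mInner_self]; positivity
      have h2 := mul_nonneg (half_pos hk₂).le this
      by_contra hcon
      push Not at hcon
      have h3 := mul_le_mul_of_nonneg_left hcon (by positivity : 0 ≤ k₁ / 4)
      linarith
    convert hdV t ht using 1
    rw [aux_pair1 η γ α G (θ t) (φ t) hu, aux_pair2 η γ α G (θ t) (φ t) hu, aux_mInner_smul]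
    simp only [Vfun, aux_mNorm_sq]
    ring
  have hle : ∀ t ≥ (0 : ℝ), Vfun k₁ k₂ (θ t, φ t) ≤ c := by
    intro T hT
    have := image_le_of_deriv_right_lt_deriv_boundary
      (f := fun s => Vfun k₁ k₂ (θ s, φ s)) (a := 0) (b := T)
      (f' := deriv (fun s => Vfun k₁ k₂ (θ s, φ s))) (B := fun _ => c) (B' := fun _ => 0)
      (fun t ht => (hdV t ht.1).continuousAt.continuousWithinAt)
      (fun t ht => ((hdV t ht.1).differentiableAt.hasDerivAt).hasDerivWithinAt)
      h0 (fun t => hasDerivAt_const t c)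
      (fun t ht he => by
        have he' : Vfun k₁ k₂ (θ t, φ t) = c := he
        rw [(hder t ht.1 he'.le).deriv, he']
        nlinarith [mul_pos hα hc0])
    exact this ⟨hT, le_refl T⟩
  have hexp : ∀ t ≥ (0 : ℝ),
      Vfun k₁ k₂ (θ t, φ t) = Real.exp (-(α * t)) * Vfun k₁ k₂ (θ 0, φ 0) := by
    intro T hT
    have hg : ∀ t ≥ (0 : ℝ),
        HasDerivAt (fun s => Real.exp (α * s) * Vfun k₁ k₂ (θ s, φ s)) 0 t := by
      intro t ht
      have h1 : HasDerivAt (fun s : ℝ => Real.exp (α * s)) (Real.exp (α * t) * (α * 1)) t :=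
        ((hasDerivAt_id t).const_mul α).exp
      refine (h1.fun_mul (hder t ht (hle t ht))).congr_deriv ?_
      ring
    have h := constant_of_has_deriv_right_zero (a := 0) (b := T)
      (fun t ht => (hg t ht.1).continuousAt.continuousWithinAt)
      (fun t ht => (hg t ht.1).hasDerivWithinAt) T ⟨hT, le_refl T⟩
    simp only [mul_zero, Real.exp_zero, one_mul] at h
    rw [← h, ← mul_assoc, ← Real.exp_add]
    simp
  refine ⟨hexp, hle, ?_⟩
  have hlim : Tendsto (fun t : ℝ => Real.exp (-(α * t)) * Vfun k₁ k₂ (θ 0, φ 0)) atTop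
      (nhds 0) := by
    have h1 : Tendsto (fun t : ℝ => Real.exp (-(α * t))) atTop (nhds 0) :=
      Real.tendsto_exp_neg_atTop_nhds_zero.comp (tendsto_id.const_mul_atTop hα)
    simpa using h1.mul_const (Vfun k₁ k₂ (θ 0, φ 0))
  refine hlim.congr' ?_
  filter_upwards [eventually_ge_atTop (0 : ℝ)] with t ht
  exact (hexp t ht).symm
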